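/- Let z ∈ ℝ^N, let (λ_j) be a sequence of positive numbers converging to 0, and for each j let μ_j be a (λ_j, z)-Mather measure. Then (μ_j) admits a subsequence converging in the narrow topology to a Borel probability measure μ on ℝ^N × ℝ^N, and every such narrow limit μ is a Mather measure. -/

import Mathlib

open MeasureTheory Set
open scoped RealInnerProductSpace

noncomputable section

abbrev Euc (N : ℕ) := EuclideanSpace ℝ (Fin N)

/-- `u` is an (a.e.) subsolution of `H = a` in `ℝ^N`. -/
def IsSubsol {N : ℕ} (H : Euc N × Euc N → ℝ) (a : ℝ) (u : Euc N → ℝ) : Prop :=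
  LocallyLipschitz u ∧
    ∀ᵐ x : Euc N ∂volume, DifferentiableAt ℝ u x → H (x, gradient u x) ≤ a

/-- `u` is an (a.e.) subsolution of the discounted equation `λ u + H(x,Du) = 0`. -/
def IsDiscSubsol {N : ℕ} (H : Euc N × Euc N → ℝ) (lam : ℝ) (u : Euc N → ℝ) : Prop :=
  LocallyLipschitz u ∧
    ∀ᵐ x : Euc N ∂volume, DifferentiableAt ℝ u x →
      lam * u x + H (x, gradient u x) ≤ 0

/-- The Lagrangian associated with `H` via the Fenchel transform. -/
def Lag {N : ℕ} (H : Euc N × Euc N → ℝ) : Euc N × Euc N → ℝ :=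
  fun z => sSup (Set.range fun p : Euc N => ⟪p, z.2⟫ - H (z.1, p))

/-- `u` is a subsolution for the generalized Lagrangian `Φ`. -/
def SubsolFor {N : ℕ} (Φ : Euc N × Euc N → ℝ) (u : Euc N → ℝ) : Prop :=
  LocallyLipschitz u ∧
    ∀ᵐ x : Euc N ∂volume, DifferentiableAt ℝ u x →
      ∀ q : Euc N, fderiv ℝ u x q ≤ Φ (x, q)

/-- `u` is a `λ`-discounted subsolution for the generalized Lagrangian `Φ`. -/
def DiscSubsolFor {N : ℕ} (lam : ℝ) (Φ : Euc N × Euc N → ℝ) (u : Euc N → ℝ) : Prop :=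
  LocallyLipschitz u ∧
    ∀ᵐ x : Euc N ∂volume, DifferentiableAt ℝ u x →
      ∀ q : Euc N, lam * u x + fderiv ℝ u x q ≤ Φ (x, q)

/-- A Mather measure for the ergodic problem. -/
def MatherMeasure {N : ℕ} (H : Euc N × Euc N → ℝ) (μ : Measure (Euc N × Euc N)) : Prop :=
  IsProbabilityMeasure μ ∧ Integrable (Lag H) μ ∧ (∫ z, Lag H z ∂μ) = 0 ∧
    ∀ Φ : Euc N × Euc N → ℝ, Continuous Φ → BddBelow (Set.range Φ) →
      (∃ u, SubsolFor Φ u) → (Integrable Φ μ → 0 ≤ ∫ z, Φ z ∂μ)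

/-- A `(λ,z)`-Mather measure (relative to the maximal discounted solution `um`). -/
def DiscMatherMeasure {N : ℕ} (H : Euc N × Euc N → ℝ) (lam : ℝ) (z : Euc N)
    (um : Euc N → ℝ) (μ : Measure (Euc N × Euc N)) : Prop :=
  IsProbabilityMeasure μ ∧ Integrable (Lag H) μ ∧ (∫ w, Lag H w ∂μ) = lam * um z ∧
    ∀ Φ : Euc N × Euc N → ℝ, Continuous Φ → BddBelow (Set.range Φ) →
      ∀ u : Euc N → ℝ, DiscSubsolFor lam Φ u →
        (Integrable Φ μ → lam * u z ≤ ∫ w, Φ w ∂μ)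

/-! ### Calculus of locally Lipschitz functions -/

theorem LocallyLipschitz.ae_differentiableAt_euc {N : ℕ} {u : Euc N → ℝ}
    (hu : LocallyLipschitz u) : ∀ᵐ x : Euc N, DifferentiableAt ℝ u x := by
  have h : ∀ n : ℕ, ∀ᵐ x : Euc N, x ∈ Metric.closedBall (0 : Euc N) n →
      DifferentiableWithinAt ℝ u (Metric.closedBall (0 : Euc N) n) x := by
    intro n
    obtain ⟨K, hK⟩ := LocallyLipschitzOn.exists_lipschitzOnWith_of_compact
      (isCompact_closedBall (0 : Euc N) (n : ℝ)) hu.locallyLipschitzOn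
    exact hK.ae_differentiableWithinAt_of_mem
  filter_upwards [ae_all_iff.2 h] with x hx
  obtain ⟨n, hn⟩ := exists_nat_gt ‖x‖
  refine (hx n (by simpa using hn.le)).differentiableAt ?_
  exact Filter.mem_of_superset (Metric.isOpen_ball.mem_nhds (by simpa using hn))
    Metric.ball_subset_closedBall

theorem fderiv_eq_of_le_of_eq {E : Type*} [NormedAddCommGroup E] [NormedSpace ℝ E]
    {f g : E → ℝ} {x : E} (hle : ∀ y, g y ≤ f y) (hx : f x = g x)
    (hf : DifferentiableAt ℝ f x) (hg : DifferentiableAt ℝ g x) :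
    fderiv ℝ f x = fderiv ℝ g x := by
  have hmin : IsLocalMin (fun y => f y - g y) x :=
    Filter.Eventually.of_forall fun y => by
      have := hle y
      simp only [hx, sub_self]
      linarith
  have h := hmin.fderiv_eq_zero
  rw [fderiv_fun_sub hf hg] at h
  exact sub_eq_zero.1 h

theorem LocallyLipschitz.exists_norm_fderiv_le {N : ℕ} {u : Euc N → ℝ}
    (hu : LocallyLipschitz u) (B : ℝ) :
    ∃ K : ℝ, 0 ≤ K ∧ ∀ x, ‖x‖ ≤ B → ‖fderiv ℝ u x‖ ≤ K := by
  obtain ⟨K, hK⟩ := LocallyLipschitzOn.exists_lipschitzOnWith_of_compact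
    (isCompact_closedBall (0 : Euc N) (B + 1)) hu.locallyLipschitzOn
  refine ⟨K, K.2, fun x hx => norm_fderiv_le_of_lipschitzOn ℝ ?_ hK⟩
  exact Filter.mem_of_superset (Metric.isOpen_ball.mem_nhds
    (by simp only [mem_ball_zero_iff]; linarith)) Metric.ball_subset_closedBall

/-- Along almost every translate of a line, an almost everywhere property holds almost
everywhere. -/
theorem ae_ae_translate_line {N : ℕ} {P : Euc N → Prop} (hP : ∀ᵐ x : Euc N, P x)
    (x e : Euc N) : ∀ᵐ w : Euc N, ∀ᵐ t : ℝ, P (x + w + t • e) := by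
  have hq : Measure.QuasiMeasurePreserving (fun p : Euc N × ℝ => x + p.1 + p.2 • e)
      (volume.prod volume) volume := by
    refine ⟨by fun_prop, Measure.AbsolutelyContinuous.mk fun s hs h0 => ?_⟩
    rw [Measure.map_apply (by fun_prop) hs, Measure.prod_apply_symm
      ((by fun_prop : Measurable fun p : Euc N × ℝ => x + p.1 + p.2 • e) hs)]
    refine (lintegral_congr fun t => ?_).trans lintegral_zero
    have : (fun w : Euc N => (w, t)) ⁻¹' ((fun p : Euc N × ℝ => x + p.1 + p.2 • e) ⁻¹' s)
        = (fun w => w + (x + t • e)) ⁻¹' s := by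
      ext w
      simp only [mem_preimage]
      rw [show x + w + t • e = w + (x + t • e) by abel]
    rw [this, measure_preimage_add_right, h0]
  exact Measure.ae_ae_of_ae_prod (hq.ae hP)

theorem LocallyLipschitz.abs_sub_le_of_ae_deriv_le {f : ℝ → ℝ} (hf : LocallyLipschitz f)
    {C : ℝ} (h : ∀ᵐ t : ℝ, t ∈ Icc (0 : ℝ) 1 → |deriv f t| ≤ C) : |f 1 - f 0| ≤ C := by
  obtain ⟨K, hK⟩ := LocallyLipschitzOn.exists_lipschitzOnWith_of_compact
    (isCompact_uIcc (a := (0 : ℝ)) (b := 1)) hf.locallyLipschitzOn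
  rw [← hK.absolutelyContinuousOnInterval.integral_deriv_eq_sub]
  have := intervalIntegral.norm_integral_le_of_norm_le_const_ae (a := 0) (b := 1)
    (f := deriv f) (C := C) (by
      filter_upwards [h] with t ht hmem
      rw [uIoc_of_le zero_le_one] at hmem
      exact ht ⟨hmem.1.le, hmem.2⟩)
  simpa using this

theorem LocallyLipschitz.abs_sub_le_of_ae_fderiv_le {N : ℕ} {u : Euc N → ℝ}
    (hu : LocallyLipschitz u) {B K : ℝ}
    (h : ∀ᵐ x : Euc N, ‖x‖ < B → DifferentiableAt ℝ u x → ‖fderiv ℝ u x‖ ≤ K)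
    {x y : Euc N} (hx : ‖x‖ < B) (hy : ‖y‖ < B) : |u y - u x| ≤ K * ‖y - x‖ := by
  have hae := ae_ae_translate_line (h.and hu.ae_differentiableAt_euc) x (y - x)
  by_contra! hlt
  have huc := hu.continuous
  have hopen : ∀ᶠ w in nhds (0 : Euc N),
      K * ‖y - x‖ < |u (y + w) - u (x + w)| ∧ ‖x + w‖ < B ∧ ‖y + w‖ < B := by
    refine (ContinuousAt.eventually_lt (by fun_prop) (by fun_prop) (by simpa using hlt)).and
      ((ContinuousAt.eventually_lt (by fun_prop) (by fun_prop) (by simpa using hx)).and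
      (ContinuousAt.eventually_lt (by fun_prop) (by fun_prop) (by simpa using hy)))
  obtain ⟨w, ⟨hw1, hw2, hw3⟩, hw⟩ :=
    mem_closure_iff_nhds.1 (Measure.dense_of_ae hae (0 : Euc N)) _ hopen
  have hline : LocallyLipschitz (fun t : ℝ => u (x + w + t • (y - x))) :=
    hu.comp (ContDiff.locallyLipschitz (𝕂 := ℝ) (by fun_prop))
  have := hline.abs_sub_le_of_ae_deriv_le (C := K * ‖y - x‖) (by
    filter_upwards [hw] with t ht hmem
    have hB : ‖x + w + t • (y - x)‖ < B := by
      have : x + w + t • (y - x) ∈ Metric.ball (0 : Euc N) B := by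
        refine (convex_ball (0 : Euc N) B).segment_subset (x := x + w) (y := y + w)
          (by simpa using hw2) (by simpa using hw3) ⟨1 - t, t, by linarith [hmem.2], hmem.1,
          by ring, ?_⟩
        module
      simpa using this
    have hd : HasDerivAt (fun t : ℝ => x + w + t • (y - x)) (y - x) t := by
      simpa using ((hasDerivAt_id t).smul_const (y - x)).const_add (x + w)
    have hc := ht.2.hasFDerivAt.comp_hasDerivAt t hd
    rw [show deriv (fun t : ℝ => u (x + w + t • (y - x))) t = _ from hc.deriv]
    exact ((fderiv ℝ u _).le_opNorm _).trans
      (mul_le_mul_of_nonneg_right (ht.1 hB ht.2) (norm_nonneg _)))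
  simp only [one_smul, zero_smul, add_zero] at this
  rw [show x + w + (y - x) = y + w by abel] at this
  linarith

theorem LocallyLipschitz.exists_truncation {N : ℕ} {w : Euc N → ℝ} (hw : LocallyLipschitz w)
    {B D ε w₀ : ℝ} (hε : 0 < ε) (hB : 0 ≤ B) (hD : ∀ x, ‖x‖ ≤ B → |w x - w₀| ≤ D) :
    ∃ v : Euc N → ℝ, LocallyLipschitz v ∧
      (∀ x, w₀ - D - 1 ≤ v x ∧ v x ≤ w₀ + D + ε * B + 1) ∧
      (∀ x, ‖x‖ ≤ B → v x = w x) ∧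
      (∀ x, B + (2 * D + 2) / ε < ‖x‖ → v x = w₀ - D - 1) ∧
      ∀ᵐ x : Euc N, (v x = w x ∧ fderiv ℝ v x = fderiv ℝ w x) ∨
        (B < ‖x‖ ∧ ‖fderiv ℝ v x‖ ≤ ε) := by
  set g : Euc N → ℝ := fun x => w₀ + D + ε * B + 1 - ε * ‖x‖ with hg
  set k : Euc N → ℝ := fun x => min (w x) (g x) with hk
  set v : Euc N → ℝ := fun x => max (k x) (w₀ - D - 1) with hv
  have hD0 : 0 ≤ D := (abs_nonneg _).trans (hD 0 (by simpa using hB))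
  have hεB : 0 ≤ ε * B := by positivity
  have hgL : LipschitzWith ⟨ε, hε.le⟩ g := by
    refine LipschitzWith.of_dist_le_mul fun x y => ?_
    rw [Real.dist_eq, dist_eq_norm]
    change |w₀ + D + ε * B + 1 - ε * ‖x‖ - (w₀ + D + ε * B + 1 - ε * ‖y‖)| ≤ ε * ‖x - y‖
    rw [show w₀ + D + ε * B + 1 - ε * ‖x‖ - (w₀ + D + ε * B + 1 - ε * ‖y‖)
      = ε * (‖y‖ - ‖x‖) by ring, abs_mul, abs_of_pos hε, norm_sub_rev]
    gcongr
    exact abs_norm_sub_norm_le y x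
  have hkL : LocallyLipschitz k := hw.min hgL.locallyLipschitz
  have hvL : LocallyLipschitz v := hkL.max_const _
  have hwg : ∀ x, ‖x‖ ≤ B → w x < g x ∧ w₀ - D - 1 < w x := by
    intro x hx
    have h := abs_le.1 (hD x hx)
    have : ε * ‖x‖ ≤ ε * B := by gcongr
    simp only [hg]
    constructor <;> linarith
  have hvw : ∀ x, ‖x‖ ≤ B → v x = w x := by
    intro x hx
    simp only [hv, hk]
    rw [min_eq_left (hwg x hx).1.le, max_eq_left (hwg x hx).2.le]
  refine ⟨v, hvL, fun x => ⟨le_max_right _ _, max_le ((min_le_right _ _).trans ?_) (by linarith)⟩,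
    hvw, fun x hx => ?_, ?_⟩
  · have : 0 ≤ ε * ‖x‖ := by positivity
    simp only [hg]
    linarith
  · refine max_eq_right ((min_le_right _ _).trans ?_)
    have h : (2 * D + 2) / ε < ‖x‖ - B := by linarith
    rw [div_lt_iff₀ hε] at h
    simp only [hg]
    linarith
  · filter_upwards [hw.ae_differentiableAt_euc, hgL.locallyLipschitz.ae_differentiableAt_euc,
      hkL.ae_differentiableAt_euc, hvL.ae_differentiableAt_euc] with x h1 h2 h3 h4
    rcases max_choice (k x) (w₀ - D - 1) with h | h
    · have hvk : fderiv ℝ v x = fderiv ℝ k x :=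
        fderiv_eq_of_le_of_eq (fun y => le_max_left _ _) h h4 h3
      rcases min_choice (w x) (g x) with h' | h'
      · exact Or.inl ⟨h.trans h', hvk.trans
          (fderiv_eq_of_le_of_eq (fun y => min_le_left _ _) h'.symm h1 h3).symm⟩
      · refine Or.inr ⟨?_, ?_⟩
        · by_contra! hx
          have := (hwg x hx).1
          have e1 : v x = g x := h.trans h'
          rw [hvw x hx] at e1
          linarith
        · rw [hvk, ← fderiv_eq_of_le_of_eq (f := g) (fun y => min_le_right _ _) h'.symm h2 h3]
          exact norm_fderiv_le_of_lipschitz ℝ hgL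
    · refine Or.inr ⟨?_, ?_⟩
      · by_contra! hx
        have e1 : v x = w₀ - D - 1 := h
        rw [hvw x hx] at e1
        linarith [(hwg x hx).2]
      · rw [fderiv_eq_of_le_of_eq (f := v) (g := fun _ => w₀ - D - 1)
          (fun y => le_max_right _ _) h h4 (differentiableAt_const _)]
        simpa using hε.le

theorem inner_gradient_eq_fderiv {N : ℕ} (u : Euc N → ℝ) (x q : Euc N) :
    ⟪gradient u x, q⟫ = fderiv ℝ u x q := by
  simp [gradient]

theorem norm_gradient_eq_norm_fderiv {N : ℕ} (u : Euc N → ℝ) (x : Euc N) :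
    ‖gradient u x‖ = ‖fderiv ℝ u x‖ := by
  simp [gradient]

theorem gradient_congr_fderiv {N : ℕ} {u v : Euc N → ℝ} {x : Euc N}
    (h : fderiv ℝ u x = fderiv ℝ v x) : gradient u x = gradient v x := by
  simp [gradient, h]

/-! ### The Lagrangian -/

theorem eventually_superlinear {N : ℕ} {H : Euc N × Euc N → ℝ} (hA1 : Continuous H)
    (hconv : ∀ x : Euc N, ConvexOn ℝ Set.univ fun p => H (x, p))
    (hsl : ∀ x : Euc N, ∀ C : ℝ, ∃ r : ℝ, ∀ p : Euc N, r ≤ ‖p‖ → C * ‖p‖ ≤ H (x, p))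
    (x₀ : Euc N) (C : ℝ) :
    ∃ r : ℝ, ∀ᶠ x in nhds x₀, ∀ p : Euc N, r ≤ ‖p‖ → H (x, 0) + C * ‖p‖ ≤ H (x, p) := by
  obtain ⟨r₀, hr₀⟩ := hsl x₀ (C + |H (x₀, 0)| + 1)
  set r := max r₀ 1 with hr
  have hr1 : 1 ≤ r := le_max_right _ _
  have hsphere : ∀ p ∈ Metric.sphere (0 : Euc N) r,
      ∀ᶠ z : Euc N × Euc N in nhds (x₀, p), H (z.1, 0) + C * r < H (z.1, z.2) := by
    intro p hp
    have hp' : ‖p‖ = r := by simpa using hp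
    refine ContinuousAt.eventually_lt (by fun_prop) (by fun_prop) ?_
    have h1 := hr₀ p (hp' ▸ le_max_left _ _)
    rw [hp'] at h1
    have h2 := le_abs_self (H (x₀, 0))
    have h3 : |H (x₀, 0)| * 1 ≤ |H (x₀, 0)| * r := by gcongr
    dsimp only
    nlinarith
  refine ⟨r, ?_⟩
  filter_upwards [(isCompact_sphere (0 : Euc N) r).eventually_forall_of_forall_eventually
    (P := fun x p => H (x, 0) + C * r < H (x, p))
    hsphere] with x hx p hp
  have hp0 : 0 < ‖p‖ := by linarith
  set s := r / ‖p‖ with hs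
  have hs0 : 0 < s := by positivity
  have hs1 : s ≤ 1 := (div_le_one hp0).2 hp
  have hsp : s * ‖p‖ = r := by rw [hs]; field_simp
  have h1 := hx (s • p) (by simp [norm_smul, abs_of_pos hs0, hsp])
  have h2 := (hconv x).2 (mem_univ (0 : Euc N)) (mem_univ p) (sub_nonneg.2 hs1) hs0.le
    (by ring)
  simp only [smul_zero, zero_add, smul_eq_mul] at h2
  rw [← hsp] at h1
  have h3 : s * (H (x, 0) + C * ‖p‖) ≤ s * H (x, p) := by nlinarith
  exact le_of_mul_le_mul_left h3 hs0

theorem inner_sub_le_of_superlinear {N : ℕ} {H : Euc N × Euc N → ℝ} {x p q : Euc N} {C : ℝ}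
    (h : H (x, 0) + C * ‖p‖ ≤ H (x, p)) (hq : ‖q‖ ≤ C) :
    ⟪p, q⟫ - H (x, p) ≤ ⟪(0 : Euc N), q⟫ - H (x, 0) := by
  have h1 := real_inner_le_norm p q
  have h2 : ‖p‖ * ‖q‖ ≤ ‖p‖ * C := by gcongr
  rw [inner_zero_left]
  linarith

theorem bddAbove_lag {N : ℕ} {H : Euc N × Euc N → ℝ} (hA1 : Continuous H)
    (hconv : ∀ x : Euc N, ConvexOn ℝ Set.univ fun p => H (x, p))
    (hsl : ∀ x : Euc N, ∀ C : ℝ, ∃ r : ℝ, ∀ p : Euc N, r ≤ ‖p‖ → C * ‖p‖ ≤ H (x, p))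
    (x q : Euc N) : BddAbove (range fun p : Euc N => ⟪p, q⟫ - H (x, p)) := by
  obtain ⟨r, hr⟩ := eventually_superlinear hA1 hconv hsl x ‖q‖
  have hr := hr.self_of_nhds
  obtain ⟨b, hb⟩ := (isCompact_closedBall (0 : Euc N) r).bddAbove_image
    (f := fun p : Euc N => ⟪p, q⟫ - H (x, p)) (by fun_prop)
  refine ⟨max b (⟪(0 : Euc N), q⟫ - H (x, 0)), ?_⟩
  rintro _ ⟨p, rfl⟩
  rcases le_total r ‖p‖ with h | h
  · exact le_max_of_le_right (inner_sub_le_of_superlinear (hr p h) le_rfl)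
  · exact le_max_of_le_left (hb ⟨p, by simpa using h, rfl⟩)

theorem inner_sub_le_lag {N : ℕ} {H : Euc N × Euc N → ℝ} (hA1 : Continuous H)
    (hconv : ∀ x : Euc N, ConvexOn ℝ Set.univ fun p => H (x, p))
    (hsl : ∀ x : Euc N, ∀ C : ℝ, ∃ r : ℝ, ∀ p : Euc N, r ≤ ‖p‖ → C * ‖p‖ ≤ H (x, p))
    (x p q : Euc N) : ⟪p, q⟫ - H (x, p) ≤ Lag H (x, q) :=
  le_csSup (bddAbove_lag hA1 hconv hsl x q) ⟨p, rfl⟩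

theorem continuous_lag {N : ℕ} {H : Euc N × Euc N → ℝ} (hA1 : Continuous H)
    (hconv : ∀ x : Euc N, ConvexOn ℝ Set.univ fun p => H (x, p))
    (hsl : ∀ x : Euc N, ∀ C : ℝ, ∃ r : ℝ, ∀ p : Euc N, r ≤ ‖p‖ → C * ‖p‖ ≤ H (x, p)) :
    Continuous (Lag H) := by
  rw [continuous_iff_continuousAt]
  rintro ⟨x₀, q₀⟩
  obtain ⟨r₀, hr₀⟩ := eventually_superlinear hA1 hconv hsl x₀ (‖q₀‖ + 1)
  set r := max r₀ 0
  have hcont : Continuous fun z : Euc N × Euc N =>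
      sSup ((fun p : Euc N => ⟪p, z.2⟫ - H (z.1, p)) '' Metric.closedBall 0 r) :=
    (isCompact_closedBall (0 : Euc N) r).continuous_sSup
      (f := fun (z : Euc N × Euc N) (p : Euc N) => ⟪p, z.2⟫ - H (z.1, p))
      (show Continuous fun y : (Euc N × Euc N) × Euc N => ⟪y.2, y.1.2⟫ - H (y.1.1, y.2) by
        fun_prop)
  refine hcont.continuousAt.congr ?_
  have hq : ∀ᶠ q in nhds q₀, ‖q‖ < ‖q₀‖ + 1 :=
    ContinuousAt.eventually_lt (by fun_prop) (by fun_prop) (by linarith)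
  filter_upwards [hr₀.prod_nhds hq] with z hz
  have hbdd := bddAbove_lag hA1 hconv hsl z.1 z.2
  have h0 : (0 : Euc N) ∈ Metric.closedBall (0 : Euc N) r := by simp [r]
  refine le_antisymm (csSup_le_csSup hbdd ⟨_, 0, h0, rfl⟩ (image_subset_range _ _))
    (csSup_le (range_nonempty _) ?_)
  have hbdd' := hbdd.mono (image_subset_range _ (Metric.closedBall 0 r))
  rintro _ ⟨p, rfl⟩
  rcases le_total ‖p‖ r with h | h
  · exact le_csSup hbdd' ⟨p, by simpa using h, rfl⟩
  · exact (inner_sub_le_of_superlinear (hz.1 p ((le_max_left _ _).trans h)) hz.2.le).trans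
      (le_csSup hbdd' ⟨0, h0, rfl⟩)

theorem mul_norm_sub_le_lag {N : ℕ} {H : Euc N × Euc N → ℝ} (hA1 : Continuous H)
    (hconv : ∀ x : Euc N, ConvexOn ℝ Set.univ fun p => H (x, p))
    (hsl : ∀ x : Euc N, ∀ C : ℝ, ∃ r : ℝ, ∀ p : Euc N, r ≤ ‖p‖ → C * ‖p‖ ≤ H (x, p))
    {x : Euc N} {r C : ℝ} (hr : 0 ≤ r) (hC : ∀ p : Euc N, ‖p‖ ≤ r → H (x, p) ≤ C)
    (q : Euc N) : r * ‖q‖ - C ≤ Lag H (x, q) := by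
  rcases eq_or_ne q 0 with rfl | hq
  · have := inner_sub_le_lag hA1 hconv hsl x 0 (0 : Euc N)
    have := hC 0 (by simpa using hr)
    simp only [inner_zero_left, norm_zero, mul_zero] at *
    linarith
  · have hq' : 0 < ‖q‖ := norm_pos_iff.2 hq
    have h1 := inner_sub_le_lag hA1 hconv hsl x ((r / ‖q‖) • q) q
    have h2 := hC ((r / ‖q‖) • q) (by
      rw [norm_smul, Real.norm_of_nonneg (by positivity), div_mul_cancel₀ _ hq'.ne'])
    rw [real_inner_smul_left, real_inner_self_eq_norm_sq] at h1
    have h3 : r / ‖q‖ * ‖q‖ ^ 2 = r * ‖q‖ := by field_simp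
    linarith

/-! ### Consequences of the assumptions on the Hamiltonian -/

theorem exists_lt_le_of_isSubsol {N : ℕ} {H : Euc N × Euc N → ℝ} (hA1 : Continuous H)
    (hcoer : ∀ R : ℝ, 0 < R → ∀ C : ℝ, ∃ r : ℝ, ∀ x p : Euc N,
      ‖x‖ ≤ R → r ≤ ‖p‖ → C ≤ H (x, p))
    {m : ℝ} {x₀ : Euc N} (hm : ∀ p : Euc N, m < H (x₀, p)) :
    ∃ m' > m, ∀ a u, IsSubsol H a u → m' ≤ a := by
  obtain ⟨r, hr⟩ := hcoer (‖x₀‖ + 1) (by positivity) (m + 1)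
  obtain ⟨p₁, -, hp₁⟩ := (isCompact_closedBall (0 : Euc N) (max r 0)).exists_isMinOn
    ⟨0, by simp⟩ (f := fun p => H (x₀, p)) (by fun_prop)
  have hm1 := hm p₁
  set m' := min (m + 1) ((m + H (x₀, p₁)) / 2) with hm'
  have hm'1 : m' ≤ m + 1 := min_le_left _ _
  have hm'2 : m' < H (x₀, p₁) := (min_le_right _ _).trans_lt (by linarith)
  have hnear : ∀ᶠ x in nhds x₀, ∀ p ∈ Metric.closedBall (0 : Euc N) (max r 0),
      m' < H (x, p) := by
    refine (isCompact_closedBall (0 : Euc N) (max r 0)).eventually_forall_of_forall_eventually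
      (P := fun x p => m' < H (x, p)) fun p hp => ?_
    exact ContinuousAt.eventually_lt (by fun_prop) (by fun_prop) (hm'2.trans_le (hp₁ hp))
  have hball : ∀ᶠ x in nhds x₀, ‖x‖ < ‖x₀‖ + 1 :=
    ContinuousAt.eventually_lt (by fun_prop) (by fun_prop) (by linarith)
  refine ⟨m', lt_min (by linarith) (by linarith), fun a u hu => ?_⟩
  obtain ⟨x, ⟨hx1, hx2⟩, hx3, hx4⟩ := mem_closure_iff_nhds.1
    (Measure.dense_of_ae (hu.1.ae_differentiableAt_euc.and hu.2) x₀) _ (hnear.and hball)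
  refine le_trans ?_ (hx4 hx3)
  rcases le_total r ‖gradient u x‖ with h | h
  · exact hm'1.trans (hr _ _ hx2.le h)
  · exact (hx1 _ (by simpa using Or.inl h)).le

/-- The consequences, for a Hamiltonian with critical value `0`, of continuity, convexity,
coercivity and of the behaviour at infinity. -/
structure CriticalHamiltonian {N : ℕ} (H : Euc N × Euc N → ℝ) (ε δ R C : ℝ) : Prop where
  continuous : Continuous H
  convex : ∀ x : Euc N, ConvexOn ℝ Set.univ fun p => H (x, p)
  coercive : ∀ R : ℝ, 0 < R → ∀ C : ℝ, ∃ r : ℝ, ∀ x p : Euc N,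
    ‖x‖ ≤ R → r ≤ ‖p‖ → C ≤ H (x, p)
  superlinear : ∀ x : Euc N, ∀ C : ℝ, ∃ r : ℝ, ∀ p : Euc N, r ≤ ‖p‖ → C * ‖p‖ ≤ H (x, p)
  eps_pos : 0 < ε
  delta_pos : 0 < δ
  radius_pos : 0 < R
  bound_nonneg : 0 ≤ C
  le_neg_delta : ∀ x p : Euc N, R ≤ ‖x‖ → ‖p‖ ≤ ε → H (x, p) ≤ -δ
  le_bound : ∀ x p : Euc N, ‖p‖ ≤ ε → H (x, p) ≤ C
  nonneg_of_isSubsol : ∀ a u, IsSubsol H a u → 0 ≤ a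
  exists_isSubsol : ∀ a : ℝ, 0 < a → ∃ b < a, ∃ u, IsSubsol H b u

theorem exists_criticalHamiltonian {N : ℕ} {H : Euc N × Euc N → ℝ} (hA1 : Continuous H)
    (hA2conv : ∀ x : Euc N, ConvexOn ℝ Set.univ fun p => H (x, p))
    (hA2coer : ∀ R : ℝ, 0 < R → ∀ C : ℝ, ∃ r : ℝ, ∀ x p : Euc N,
      ‖x‖ ≤ R → r ≤ ‖p‖ → C ≤ H (x, p))
    (hA3 : ∃ ε > (0 : ℝ), ∃ m : ℝ,
      (∃ R : ℝ, ∀ x : Euc N, R ≤ ‖x‖ → ∀ p : Euc N, ‖p‖ ≤ ε → H (x, p) ≤ m) ∧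
      (∃ x₀ : Euc N, ∀ p : Euc N, m < H (x₀, p)))
    (hcrit : sInf {a : ℝ | ∃ u : Euc N → ℝ, IsSubsol H a u} = 0)
    (hsl : ∀ x : Euc N, ∀ C : ℝ, ∃ r : ℝ, ∀ p : Euc N, r ≤ ‖p‖ → C * ‖p‖ ≤ H (x, p)) :
    ∃ ε δ R C : ℝ, CriticalHamiltonian H ε δ R C := by
  obtain ⟨ε, hε, m, ⟨R, hR⟩, x₀, hx₀⟩ := hA3
  obtain ⟨m', hm', hlow⟩ := exists_lt_le_of_isSubsol hA1 hA2coer hx₀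
  obtain ⟨b, hb⟩ := ((isCompact_closedBall (0 : Euc N) R).prod
    (isCompact_closedBall (0 : Euc N) ε)).bddAbove_image (f := H) (by fun_prop)
  have hbound : ∀ x p : Euc N, ‖p‖ ≤ ε → H (x, p) ≤ max (max b m) 0 := by
    intro x p hp
    rcases le_total R ‖x‖ with h | h
    · exact (hR x h p hp).trans ((le_max_right _ _).trans (le_max_left _ _))
    · exact (hb ⟨(x, p), ⟨by simpa using h, by simpa using hp⟩, rfl⟩).trans
        ((le_max_left _ _).trans (le_max_left _ _))
  have hne : {a : ℝ | ∃ u : Euc N → ℝ, IsSubsol H a u}.Nonempty := by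
    refine ⟨max (max b m) 0, fun _ => 0, LocallyLipschitz.const 0,
      Filter.Eventually.of_forall fun x _ => hbound x _ ?_⟩
    rw [norm_gradient_eq_norm_fderiv]
    simpa using hε.le
  have hbdd : BddBelow {a : ℝ | ∃ u : Euc N → ℝ, IsSubsol H a u} :=
    ⟨m', fun a ⟨u, hu⟩ => hlow a u hu⟩
  have hm'0 : m' ≤ 0 := hcrit ▸ le_csInf hne fun a ⟨u, hu⟩ => hlow a u hu
  refine ⟨ε, -m, max R 1, max (max b m) 0, hA1, hA2conv, hA2coer, hsl, hε, by linarith,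
    by positivity, le_max_right _ _, fun x p hx hp => ?_, hbound, fun a u hu => ?_,
    fun a ha => ?_⟩
  · rw [neg_neg]
    exact hR x ((le_max_left _ _).trans hx) p hp
  · rw [← hcrit]
    exact csInf_le hbdd ⟨u, hu⟩
  · obtain ⟨b, ⟨u, hu⟩, hba⟩ := exists_lt_of_csInf_lt hne (hcrit ▸ ha)
    exact ⟨b, hba, u, hu⟩

namespace CriticalHamiltonian

variable {N : ℕ} {H : Euc N × Euc N → ℝ} {ε δ R C : ℝ}

theorem exists_norm_le (hH : CriticalHamiltonian H ε δ R C) (B c : ℝ) :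
    ∃ K : ℝ, 0 ≤ K ∧ ∀ x p : Euc N, ‖x‖ ≤ B → H (x, p) ≤ c → ‖p‖ ≤ K := by
  obtain ⟨r, hr⟩ := hH.coercive (max B 1) (by positivity) (c + 1)
  refine ⟨max r 0, le_max_right _ _, fun x p hx hp => ?_⟩
  by_contra! h
  have := hr x p (hx.trans (le_max_left _ _)) ((le_max_left _ _).trans h.le)
  linarith

/-- Equi-oscillation, on balls, of locally Lipschitz functions with `H(x,Du) ≤ c`. -/
theorem exists_abs_sub_le (hH : CriticalHamiltonian H ε δ R C) (B c : ℝ) :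
    ∃ D : ℝ, 0 ≤ D ∧ ∀ u : Euc N → ℝ, LocallyLipschitz u →
      (∀ᵐ x : Euc N, DifferentiableAt ℝ u x → H (x, gradient u x) ≤ c) →
      ∀ x y, ‖x‖ ≤ B → ‖y‖ ≤ B → |u x - u y| ≤ D := by
  obtain ⟨K, hK0, hK⟩ := hH.exists_norm_le (B + 1) c
  refine ⟨K * (2 * max B 0), by positivity, fun u hu hae x y hx hy => ?_⟩
  have h := hu.abs_sub_le_of_ae_fderiv_le (B := B + 1) (K := K) (x := y) (y := x) (by
    filter_upwards [hae] with x hx hxB hd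
    rw [← norm_gradient_eq_norm_fderiv]
    exact hK x _ hxB.le (hx hd)) (by linarith) (by linarith)
  refine h.trans ?_
  gcongr
  have := norm_sub_le x y
  have := le_max_left B 0
  linarith

theorem isDiscSubsol_max (hH : CriticalHamiltonian H ε δ R C) {lam : ℝ} (hlam : 0 < lam)
    {u : Euc N → ℝ} (hu : IsDiscSubsol H lam u) :
    IsDiscSubsol H lam fun x => max (u x) (-C / lam) := by
  have hL := hu.1.max_const (-C / lam)
  refine ⟨hL, ?_⟩
  filter_upwards [hu.1.ae_differentiableAt_euc, hu.2] with x hd hx hd'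
  rcases max_choice (u x) (-C / lam) with h | h
  · rw [gradient_congr_fderiv (fderiv_eq_of_le_of_eq (fun y => le_max_left _ _) h hd' hd), h]
    exact hx hd
  · have hg := fderiv_eq_of_le_of_eq (g := fun _ : Euc N => -C / lam)
      (fun y => le_max_right _ _) h hd' (differentiableAt_const _)
    have h1 := hH.le_bound x (gradient (fun x => max (u x) (-C / lam)) x) (by
      rw [norm_gradient_eq_norm_fderiv, hg]
      simpa using hH.eps_pos.le)
    rw [h, mul_div_cancel₀ _ hlam.ne']
    linarith

theorem exists_mul_le_of_isDiscSubsol (hH : CriticalHamiltonian H ε δ R C) (z : Euc N)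
    {η : ℝ} (hη : 0 < η) :
    ∃ lam₀ > 0, ∀ lam, 0 < lam → lam < lam₀ → ∀ u, IsDiscSubsol H lam u → lam * u z ≤ η := by
  obtain ⟨D, hD0, hD⟩ := hH.exists_abs_sub_le (R + ‖z‖) C
  refine ⟨η / (D + 1), by positivity, fun lam hlam hlt u hu => ?_⟩
  rw [lt_div_iff₀ (by positivity)] at hlt
  by_contra! hcon
  set w : Euc N → ℝ := fun x => max (u x) (-C / lam) with hw
  have hwsub : IsDiscSubsol H lam w := hH.isDiscSubsol_max hlam hu
  have hR := hH.radius_pos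
  obtain ⟨v, hvL, hvb, -, -, hvae⟩ := hwsub.1.exists_truncation (B := R + ‖z‖) (D := D)
    (w₀ := w z) hH.eps_pos (by positivity) fun x hx => hD w hwsub.1 (by
      filter_upwards [hwsub.2] with x hx hd
      have h1 := hx hd
      have h2 : lam * (-C / lam) ≤ lam * w x := by gcongr; exact le_max_right _ _
      rw [mul_div_cancel₀ _ hlam.ne'] at h2
      linarith) x z hx (by linarith)
  have hwz : lam * u z ≤ lam * w z := by gcongr; exact le_max_left _ _
  have hsub : IsSubsol H (max (-δ) (-(lam * (w z - D - 1)))) v := by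
    refine ⟨hvL, ?_⟩
    filter_upwards [hvae, hwsub.2, hwsub.1.ae_differentiableAt_euc] with x hx hx2 hd _
    rcases hx with ⟨h1, h2⟩ | ⟨h1, h2⟩
    · rw [gradient_congr_fderiv h2]
      have h3 := hx2 hd
      have h4 : lam * (w z - D - 1) ≤ lam * w x := by
        gcongr
        rw [← h1]
        exact (hvb x).1
      exact le_max_of_le_right (by linarith)
    · rw [← norm_gradient_eq_norm_fderiv] at h2
      exact le_max_of_le_left (hH.le_neg_delta x _ (by linarith [norm_nonneg z]) h2)
  have h0 := hH.nonneg_of_isSubsol _ _ hsub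
  have hδ := hH.delta_pos
  rcases le_max_iff.1 h0 with h | h
  · linarith
  · nlinarith

/-- Almost critical subsolutions which are uniformly bounded, and constant outside a ball which
does not depend on the level. -/
theorem exists_bounded_subsol (hH : CriticalHamiltonian H ε δ R C) :
    ∃ ρ A : ℝ, R ≤ ρ ∧ 0 ≤ A ∧ ∀ a : ℝ, 0 < a → ∃ v : Euc N → ℝ, LocallyLipschitz v ∧
      (∀ x, -A ≤ v x ∧ v x ≤ 0) ∧
      ∀ᵐ x : Euc N, H (x, gradient v x) ≤ a ∧ (ρ < ‖x‖ → fderiv ℝ v x = 0) := by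
  obtain ⟨D, hD0, hD⟩ := hH.exists_abs_sub_le R 1
  have hR := hH.radius_pos
  have hε := hH.eps_pos
  refine ⟨R + (2 * D + 2) / ε, 2 * D + ε * R + 2, by simp; positivity, by positivity,
    fun a ha => ?_⟩
  obtain ⟨b, hb, w, hw⟩ := hH.exists_isSubsol (min a 1) (by positivity)
  have hba : b ≤ a := hb.le.trans (min_le_left _ _)
  obtain ⟨v, hvL, hvb, -, hvc, hvae⟩ := hw.1.exists_truncation (B := R) (D := D) (w₀ := w 0)
    hε hR.le fun x hx => hD w hw.1 (by
      filter_upwards [hw.2] with x hx hd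
      exact (hx hd).trans (hb.le.trans (min_le_right _ _))) x 0 hx (by simpa using hR.le)
  have hfd : ∀ x, fderiv ℝ (fun x => v x - (w 0 + D + ε * R + 1)) x = fderiv ℝ v x :=
    fun x => fderiv_sub_const _
  refine ⟨fun x => v x - (w 0 + D + ε * R + 1), ?_, fun x => ?_, ?_⟩
  · simpa [sub_eq_add_neg] using hvL.add (LocallyLipschitz.const (-(w 0 + D + ε * R + 1)))
  · constructor <;> linarith [(hvb x).1, (hvb x).2]
  · filter_upwards [hvae, hw.2, hw.1.ae_differentiableAt_euc] with x hx hx2 hd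
    rw [hfd, gradient_congr_fderiv (hfd x)]
    refine ⟨?_, fun hρ => ?_⟩
    · rcases hx with ⟨-, h2⟩ | ⟨h1, h2⟩
      · rw [gradient_congr_fderiv h2]
        exact (hx2 hd).trans hba
      · rw [← norm_gradient_eq_norm_fderiv] at h2
        have := hH.le_neg_delta x _ h1.le h2
        linarith [hH.delta_pos]
    · have : v =ᶠ[nhds x] fun _ => w 0 - D - 1 := by
        filter_upwards [(isOpen_lt continuous_const continuous_norm).mem_nhds hρ] with y hy
        exact hvc y hy
      rw [this.fderiv_eq]
      simp

end CriticalHamiltonian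

/-! ### Narrow limits -/

theorem integral_le_of_tendsto {Ω : Type*} [MeasurableSpace Ω] [TopologicalSpace Ω]
    [HasOuterApproxClosed Ω] [BorelSpace Ω] {μs : ℕ → ProbabilityMeasure Ω}
    {μ : ProbabilityMeasure Ω} (hμ : Filter.Tendsto μs Filter.atTop (nhds μ)) {f : Ω → ℝ}
    (hf : Continuous f) (hbdd : BddBelow (range f)) {s : ℝ}
    (hs : ∀ e > 0, ∀ᶠ j in Filter.atTop,
      Integrable f (μs j : Measure Ω) ∧ ∫ x, f x ∂(μs j : Measure Ω) ≤ s + e) :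
    Integrable f (μ : Measure Ω) ∧ ∫ x, f x ∂(μ : Measure Ω) ≤ s := by
  obtain ⟨b, hb⟩ := hbdd
  have hb : ∀ x, b ≤ f x := fun x => hb ⟨x, rfl⟩
  have hnn : ∀ x, 0 ≤ f x - b := fun x => sub_nonneg.2 (hb x)
  have hliminf := lintegral_le_liminf_lintegral_of_forall_isOpen_measure_le_liminf_measure
    (μ := (μ : Measure Ω)) (μs := fun j => (μs j : Measure Ω)) (f := fun x => f x - b)
    (by fun_prop) hnn fun G hG => ProbabilityMeasure.le_liminf_measure_open_of_tendsto hμ hG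
  have hlint : ∀ e > 0, b ≤ s + e ∧
      ∫⁻ x, ENNReal.ofReal (f x - b) ∂(μ : Measure Ω) ≤ ENNReal.ofReal (s + e - b) := by
    intro e he
    have hev : ∀ᶠ j in Filter.atTop, b ≤ s + e ∧
        ∫⁻ x, ENNReal.ofReal (f x - b) ∂(μs j : Measure Ω) ≤ ENNReal.ofReal (s + e - b) := by
      filter_upwards [hs e he] with j hj
      have hfint : ∫ x, (f x - b) ∂(μs j : Measure Ω) = ∫ x, f x ∂(μs j : Measure Ω) - b := by
        rw [integral_sub hj.1 (integrable_const b)]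
        simp
      have h0 : 0 ≤ ∫ x, (f x - b) ∂(μs j : Measure Ω) := integral_nonneg hnn
      refine ⟨by linarith [hj.2], ?_⟩
      have hfi : Integrable (fun x => f x - b) (μs j : Measure Ω) :=
        hj.1.sub (integrable_const b)
      rw [← ofReal_integral_eq_lintegral_ofReal hfi (Filter.Eventually.of_forall hnn)]
      exact ENNReal.ofReal_le_ofReal (by linarith [hj.2])
    obtain ⟨j, hj⟩ := hev.exists
    refine ⟨hj.1, hliminf.trans ?_⟩
    exact Filter.liminf_le_of_le (by isBoundedDefault) fun c hc => by
      obtain ⟨k, hk1, hk2⟩ := (hc.and hev).exists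
      exact hk1.trans hk2.2
  have hintb : Integrable (fun x => f x - b) (μ : Measure Ω) := by
    refine ⟨by fun_prop, ?_⟩
    rw [hasFiniteIntegral_iff_ofReal (Filter.Eventually.of_forall hnn)]
    exact (hlint 1 one_pos).2.trans_lt ENNReal.ofReal_lt_top
  have hfint : Integrable f (μ : Measure Ω) := by
    exact (hintb.add (integrable_const b)).congr (Filter.Eventually.of_forall fun x => by simp)
  refine ⟨hfint, le_of_forall_pos_le_add fun e he => ?_⟩
  obtain ⟨h1, h2⟩ := hlint e he
  rw [← ofReal_integral_eq_lintegral_ofReal hintb (Filter.Eventually.of_forall hnn),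
    ENNReal.ofReal_le_ofReal_iff (by linarith), integral_sub hfint (integrable_const b)] at h2
  simp only [integral_const, probReal_univ, smul_eq_mul, one_mul] at h2
  linarith

/-- A continuous cutoff function, equal to `1` on the ball of radius `s` and vanishing outside
the ball of radius `s + 1`. -/
def ballCutoff {N : ℕ} (s : ℝ) (x : Euc N) : ℝ := max 0 (min 1 (s + 1 - ‖x‖))

section ballCutoff

variable {N : ℕ} {s t : ℝ} {x : Euc N}

@[fun_prop]
theorem continuous_ballCutoff (s : ℝ) : Continuous (ballCutoff (N := N) s) := by
  unfold ballCutoff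
  fun_prop

theorem ballCutoff_nonneg (s : ℝ) (x : Euc N) : 0 ≤ ballCutoff s x := le_max_left _ _

theorem ballCutoff_le_one (s : ℝ) (x : Euc N) : ballCutoff s x ≤ 1 :=
  max_le zero_le_one (min_le_left _ _)

theorem ballCutoff_eq_one (h : ‖x‖ ≤ s) : ballCutoff s x = 1 := by
  rw [ballCutoff, min_eq_left (by linarith), max_eq_right zero_le_one]

theorem ballCutoff_eq_zero (h : s + 1 ≤ ‖x‖) : ballCutoff s x = 0 :=
  max_eq_left ((min_le_right _ _).trans (by linarith))

theorem ballCutoff_mono (h : s ≤ t) : ballCutoff s x ≤ ballCutoff t x := by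
  unfold ballCutoff
  gcongr

end ballCutoff

theorem integrable_one_sub_ballCutoff {N : ℕ} (ρ : ℝ) (μ : Measure (Euc N × Euc N))
    [IsFiniteMeasure μ] : Integrable (fun w : Euc N × Euc N => 1 - ballCutoff ρ w.1) μ := by
  refine (integrable_const (1 : ℝ)).mono' (by fun_prop)
    (Filter.Eventually.of_forall fun w => ?_)
  rw [Real.norm_of_nonneg (sub_nonneg.2 (ballCutoff_le_one _ _))]
  linarith [ballCutoff_nonneg ρ w.1]

theorem DiscMatherMeasure.neg_mul_le_integral {N : ℕ} {H : Euc N × Euc N → ℝ} {lam : ℝ}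
    {z : Euc N} {um : Euc N → ℝ} {μ : Measure (Euc N × Euc N)}
    (hμ : DiscMatherMeasure H lam z um μ) (hlam : 0 < lam) {Φ : Euc N × Euc N → ℝ}
    (hΦ : Continuous Φ) (hb : BddBelow (range Φ)) (hΦint : Integrable Φ μ)
    {v : Euc N → ℝ} (hv : SubsolFor Φ v) {lo hi : ℝ} (hlo : ∀ x, lo ≤ v x)
    (hhi : ∀ x, v x ≤ hi) : -(lam * (hi - lo)) ≤ ∫ w, Φ w ∂μ := by
  have hsub : DiscSubsolFor lam Φ fun x => v x - hi := by
    refine ⟨by simpa [sub_eq_add_neg] using hv.1.add (LocallyLipschitz.const (-hi)), ?_⟩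
    filter_upwards [hv.2] with x hx hd q
    have h1 := hx (by simpa using hd.add_const hi) q
    rw [fderiv_sub_const]
    have : lam * (v x - hi) ≤ 0 :=
      mul_nonpos_of_nonneg_of_nonpos hlam.le (by linarith [hhi x])
    linarith
  refine le_trans ?_ (hμ.2.2.2 Φ hΦ hb _ hsub hΦint)
  nlinarith [hlo z]

namespace CriticalHamiltonian

variable {N : ℕ} {H : Euc N × Euc N → ℝ} {ε δ R C : ℝ}

theorem continuous_lag (hH : CriticalHamiltonian H ε δ R C) : Continuous (Lag H) :=
  _root_.continuous_lag hH.continuous hH.convex hH.superlinear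

theorem eps_mul_norm_le_lag (hH : CriticalHamiltonian H ε δ R C) (w : Euc N × Euc N) :
    ε * ‖w.2‖ ≤ Lag H w + C := by
  have := mul_norm_sub_le_lag hH.continuous hH.convex hH.superlinear hH.eps_pos.le
    (hH.le_bound w.1) w.2
  linarith

theorem neg_le_lag (hH : CriticalHamiltonian H ε δ R C) (w : Euc N × Euc N) :
    -C ≤ Lag H w := by
  have := hH.eps_mul_norm_le_lag w
  have := mul_nonneg hH.eps_pos.le (norm_nonneg w.2)
  linarith

theorem exists_mul_norm_le_lag (hH : CriticalHamiltonian H ε δ R C) (S : ℝ) {k : ℝ}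
    (hk : 0 ≤ k) : ∃ M : ℝ, ∀ w : Euc N × Euc N, ‖w.1‖ ≤ S → k * ‖w.2‖ ≤ Lag H w + M := by
  have hc := hH.continuous
  obtain ⟨M, hM⟩ := ((isCompact_closedBall (0 : Euc N) S).prod
    (isCompact_closedBall (0 : Euc N) k)).bddAbove_image (f := H) (by fun_prop)
  refine ⟨M, fun w hw => ?_⟩
  have := mul_norm_sub_le_lag hH.continuous hH.convex hH.superlinear hk (x := w.1) (C := M)
    (fun p hp => hM ⟨(w.1, p), ⟨by simpa using hw, by simpa using hp⟩, rfl⟩) w.2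
  linarith

theorem integrable_norm_snd (hH : CriticalHamiltonian H ε δ R C)
    {μ : Measure (Euc N × Euc N)} [IsFiniteMeasure μ] (hL : Integrable (Lag H) μ) :
    Integrable (fun w : Euc N × Euc N => ‖w.2‖) μ := by
  refine ((hL.add (integrable_const C)).const_mul ε⁻¹).mono' (by fun_prop)
    (Filter.Eventually.of_forall fun w => ?_)
  rw [norm_norm, le_inv_mul_iff₀ hH.eps_pos]
  exact hH.eps_mul_norm_le_lag w

theorem subsolFor_of_le (hH : CriticalHamiltonian H ε δ R C) {v : Euc N → ℝ}
    (hv : LocallyLipschitz v) {g : Euc N → ℝ} (h : ∀ᵐ x : Euc N, H (x, gradient v x) ≤ g x) :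
    SubsolFor (fun w => Lag H w + g w.1) v := by
  refine ⟨hv, ?_⟩
  filter_upwards [h] with x hx _ q
  have := inner_sub_le_lag hH.continuous hH.convex hH.superlinear x (gradient v x) q
  rw [inner_gradient_eq_fderiv] at this
  linarith

/-- Discounted Mather measures put little mass far away. -/
theorem exists_mul_integral_cutoff_le (hH : CriticalHamiltonian H ε δ R C) :
    ∃ ρ A : ℝ, 0 ≤ A ∧ ∀ (lam : ℝ) (z : Euc N) (um : Euc N → ℝ)
      (μ : Measure (Euc N × Euc N)), 0 < lam → DiscMatherMeasure H lam z um μ →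
      δ * ∫ w, (1 - ballCutoff ρ w.1) ∂μ ≤ lam * um z + lam * A := by
  obtain ⟨ρ, A, hρ, hA, hv⟩ := hH.exists_bounded_subsol
  refine ⟨ρ, A, hA, fun lam z um μ hlam hμ => le_of_forall_pos_le_add fun a ha => ?_⟩
  obtain ⟨v, hvL, hvb, hvae⟩ := hv a ha
  have := hμ.1
  have hLc := hH.continuous_lag
  have hδ := hH.delta_pos
  set g : Euc N → ℝ := fun x => a - δ * (1 - ballCutoff ρ x) with hg
  have hsub : SubsolFor (fun w => Lag H w + g w.1) v := by
    refine hH.subsolFor_of_le hvL ?_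
    filter_upwards [hvae] with x hx
    rcases le_or_gt ‖x‖ ρ with h | h
    · simpa [hg, ballCutoff_eq_one h] using hx.1
    · have h1 := hH.le_neg_delta x (gradient v x) (hρ.trans h.le) (by
        rw [norm_gradient_eq_norm_fderiv, hx.2 h, norm_zero]
        exact hH.eps_pos.le)
      have h2 := mul_nonneg hδ.le (ballCutoff_nonneg ρ x)
      simp only [hg]
      linarith
  have hcut := integrable_one_sub_ballCutoff ρ μ
  have hgint : Integrable (fun w : Euc N × Euc N => g w.1) μ :=
    (integrable_const a).sub (hcut.const_mul δ)
  have key := hμ.neg_mul_le_integral (Φ := fun w => Lag H w + g w.1) hlam (by fun_prop)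
    ⟨-C - δ, ?_⟩ (hμ.2.1.add hgint) hsub (fun x => (hvb x).1) (fun x => (hvb x).2)
  · rw [integral_add hμ.2.1 hgint, hμ.2.2.1, integral_sub (integrable_const a)
      (hcut.const_mul δ), integral_const_mul] at key
    simp only [integral_const, probReal_univ, smul_eq_mul, one_mul] at key
    linarith
  · rintro _ ⟨w, rfl⟩
    have h1 := hH.neg_le_lag w
    have h2 := mul_nonneg hδ.le (ballCutoff_nonneg ρ w.1)
    simp only [hg]
    linarith

end CriticalHamiltonian

/-- A subsolution for `Φ` can be localized: there is a bounded subsolution for a function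
supported in a cylinder, growing at most linearly and lying below `Φ` over a given ball. -/
theorem SubsolFor.exists_localization {N : ℕ} {Φ : Euc N × Euc N → ℝ} {u : Euc N → ℝ}
    (hu : SubsolFor Φ u) (hΦ : Continuous Φ) {b ρ : ℝ} (hb : 0 ≤ b) (hΦb : ∀ w, -b ≤ Φ w)
    (hρ : 0 ≤ ρ) : ∃ (Ψ : Euc N × Euc N → ℝ) (v : Euc N → ℝ) (S K lo hi : ℝ),
      Continuous Ψ ∧ SubsolFor Ψ v ∧ (∀ x, lo ≤ v x) ∧ (∀ x, v x ≤ hi) ∧ 0 ≤ K ∧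
      (∀ w, -b ≤ Ψ w) ∧ (∀ w, Ψ w ≤ K * ‖w.2‖) ∧ (∀ w, S ≤ ‖w.1‖ → Ψ w ≤ 0) ∧
      ∀ w, ‖w.1‖ ≤ ρ → Ψ w ≤ Φ w := by
  have huc := hu.1.continuous
  obtain ⟨D, hD⟩ := (isCompact_closedBall (0 : Euc N) (ρ + 2)).exists_bound_of_continuousOn
    (f := fun x => u x - u 0) (by fun_prop)
  have hD : ∀ x, ‖x‖ ≤ ρ + 2 → |u x - u 0| ≤ D := fun x hx => hD x (by simpa using hx)
  have hD0 : 0 ≤ D := (abs_nonneg _).trans (hD 0 (by simp; linarith))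
  obtain ⟨v, hvL, hvb, hvu, hvc, -⟩ :=
    hu.1.exists_truncation (ε := 1) one_pos (by linarith : 0 ≤ ρ + 2) hD
  set S := ρ + 2 + (2 * D + 2) / 1 with hS
  have hρS : ρ + 2 ≤ S := by
    rw [hS, div_one]
    linarith
  obtain ⟨K, hK0, hK⟩ := hvL.exists_norm_fderiv_le S
  refine ⟨fun w => ballCutoff ρ w.1 * min (Φ w) (K * ‖w.2‖) +
    (ballCutoff S w.1 - ballCutoff ρ w.1) * (K * ‖w.2‖), v, S + 1, K, _, _, by fun_prop,
    ⟨hvL, ?_⟩, fun x => (hvb x).1, fun x => (hvb x).2, hK0, fun w => ?_, fun w => ?_,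
    fun w hw => ?_, fun w hw => ?_⟩
  · filter_upwards [hu.2] with x hx _ q
    have hKq : ‖x‖ ≤ S → fderiv ℝ v x q ≤ K * ‖q‖ := fun h =>
      (le_abs_self _).trans (((fderiv ℝ v x).le_opNorm q).trans
        (mul_le_mul_of_nonneg_right (hK x h) (norm_nonneg q)))
    rcases lt_or_ge ‖x‖ (ρ + 2) with h | h
    · have heq : v =ᶠ[nhds x] u := by
        filter_upwards [(isOpen_lt continuous_norm continuous_const).mem_nhds h] with y hy
        exact hvu y (le_of_lt hy)
      have h1 := hKq (by linarith)
      have h2 : fderiv ℝ v x q ≤ Φ (x, q) := by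
        rw [heq.fderiv_eq]
        exact hx (heq.differentiableAt_iff.1 ‹_›) q
      have h3 := mul_le_mul_of_nonneg_left (le_min h2 h1) (ballCutoff_nonneg ρ x)
      have h4 := mul_le_mul_of_nonneg_left h1 (sub_nonneg.2 (ballCutoff_le_one ρ x))
      rw [ballCutoff_eq_one (by linarith : ‖x‖ ≤ S)]
      linarith
    · rw [ballCutoff_eq_zero (by linarith : ρ + 1 ≤ ‖x‖)]
      rcases le_or_gt ‖x‖ S with h' | h'
      · rw [ballCutoff_eq_one h']
        linarith [hKq h']
      · have heq : v =ᶠ[nhds x] fun _ => u 0 - D - 1 := by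
          filter_upwards [(isOpen_lt continuous_const continuous_norm).mem_nhds h'] with y hy
          exact hvc y hy
        rw [heq.fderiv_eq, fderiv_fun_const]
        have := mul_nonneg (ballCutoff_nonneg S x) (mul_nonneg hK0 (norm_nonneg q))
        simpa using this
  · have h0 := mul_nonneg hK0 (norm_nonneg w.2)
    have h1 := mul_le_mul_of_nonneg_left (le_min (hΦb w) (by linarith : -b ≤ K * ‖w.2‖))
      (ballCutoff_nonneg ρ w.1)
    have h2 := mul_nonneg (sub_nonneg.2 (ballCutoff_mono (x := w.1) (by linarith : ρ ≤ S))) h0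
    have h3 := mul_le_mul_of_nonneg_right (ballCutoff_le_one ρ w.1) hb
    linarith
  · have h0 := mul_nonneg hK0 (norm_nonneg w.2)
    have h1 := mul_le_mul_of_nonneg_left (min_le_right (Φ w) (K * ‖w.2‖))
      (ballCutoff_nonneg ρ w.1)
    have h2 := mul_le_mul_of_nonneg_right (ballCutoff_le_one S w.1) h0
    linarith
  · dsimp only
    rw [ballCutoff_eq_zero hw, ballCutoff_eq_zero (by linarith : ρ + 1 ≤ ‖w.1‖)]
    simp
  · dsimp only
    rw [ballCutoff_eq_one hw, ballCutoff_eq_one (by linarith : ‖w.1‖ ≤ S)]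
    simp

/-- A sequence of discounted Mather measures with vanishing discount factors. -/
structure IsVanishingDiscSeq {N : ℕ} (H : Euc N × Euc N → ℝ) (z : Euc N) (lams : ℕ → ℝ)
    (ums : ℕ → Euc N → ℝ) (μs : ℕ → ProbabilityMeasure (Euc N × Euc N)) : Prop where
  pos : ∀ j, 0 < lams j
  tendsto_zero : Filter.Tendsto lams Filter.atTop (nhds 0)
  discMatherMeasure : ∀ j,
    DiscMatherMeasure H (lams j) z (ums j) (μs j : Measure (Euc N × Euc N))
  eventually_mul_le : ∀ η > 0, ∀ᶠ j in Filter.atTop, lams j * ums j z ≤ η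

namespace IsVanishingDiscSeq

variable {N : ℕ} {H : Euc N × Euc N → ℝ} {ε δ R C : ℝ} {z : Euc N} {lams : ℕ → ℝ}
  {ums : ℕ → Euc N → ℝ} {μs : ℕ → ProbabilityMeasure (Euc N × Euc N)}
  {μ : ProbabilityMeasure (Euc N × Euc N)}

theorem comp (hs : IsVanishingDiscSeq H z lams ums μs) {φ : ℕ → ℕ} (hφ : StrictMono φ) :
    IsVanishingDiscSeq H z (lams ∘ φ) (ums ∘ φ) (μs ∘ φ) where
  pos _ := hs.pos _
  tendsto_zero := hs.tendsto_zero.comp hφ.tendsto_atTop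
  discMatherMeasure _ := hs.discMatherMeasure _
  eventually_mul_le η hη := hφ.tendsto_atTop.eventually (hs.eventually_mul_le η hη)

theorem exists_eventually_integral_cutoff_le (hs : IsVanishingDiscSeq H z lams ums μs)
    (hH : CriticalHamiltonian H ε δ R C) : ∃ ρ : ℝ, ∀ e > 0, ∀ᶠ j in Filter.atTop,
      ∫ w, (1 - ballCutoff ρ w.1) ∂(μs j : Measure (Euc N × Euc N)) ≤ e := by
  obtain ⟨ρ, A, -, hρ⟩ := hH.exists_mul_integral_cutoff_le
  refine ⟨ρ, fun e he => ?_⟩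
  have hδe : 0 < δ * e / 2 := by
    have := hH.delta_pos
    positivity
  have hA : Filter.Tendsto (fun j => lams j * A) Filter.atTop (nhds 0) := by
    simpa using hs.tendsto_zero.mul_const A
  filter_upwards [hs.eventually_mul_le _ hδe, hA.eventually_lt_const hδe] with j h1 h2
  have h3 := hρ _ _ _ _ (hs.pos j) (hs.discMatherMeasure j)
  exact le_of_mul_le_mul_left (by linarith) hH.delta_pos

theorem eventually_integral_norm_snd_le (hs : IsVanishingDiscSeq H z lams ums μs)
    (hH : CriticalHamiltonian H ε δ R C) : ∀ᶠ j in Filter.atTop,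
      ε * ∫ w, ‖w.2‖ ∂(μs j : Measure (Euc N × Euc N)) ≤ 1 + C := by
  filter_upwards [hs.eventually_mul_le 1 one_pos] with j hj
  obtain ⟨-, hLi, hLe, -⟩ := hs.discMatherMeasure j
  have h := integral_mono (μ := (μs j : Measure (Euc N × Euc N)))
    ((hH.integrable_norm_snd hLi).const_mul ε) (hLi.add (integrable_const C))
    hH.eps_mul_norm_le_lag
  rw [integral_const_mul, integral_add' hLi (integrable_const C), hLe] at h
  simp only [integral_const, probReal_univ, smul_eq_mul, one_mul] at h
  linarith

theorem isTightMeasureSet (hs : IsVanishingDiscSeq H z lams ums μs)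
    (hH : CriticalHamiltonian H ε δ R C) :
    IsTightMeasureSet (range fun j => (μs j : Measure (Euc N × Euc N))) := by
  obtain ⟨ρ, hρ⟩ := hs.exists_eventually_integral_cutoff_le hH
  have hε := hH.eps_pos
  have hC := hH.bound_nonneg
  refine isTightMeasureSet_range_of_tendsto_limsup_measure_norm_gt
    (ENNReal.tendsto_nhds_zero.2 fun e he => ?_)
  obtain ⟨e', he'0, he'⟩ : ∃ e' : ℝ, 0 < e' ∧ ENNReal.ofReal e' ≤ e := by
    rcases eq_or_ne e ⊤ with rfl | h
    · exact ⟨1, one_pos, le_top⟩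
    · exact ⟨e.toReal, ENNReal.toReal_pos he.ne' h, ENNReal.ofReal_toReal_le⟩
  filter_upwards [Filter.eventually_ge_atTop (ρ + 1), Filter.eventually_gt_atTop 0,
    Filter.eventually_ge_atTop ((1 + C) / (ε * (e' / 2)))] with r hr1 hr2 hr3
  refine Filter.limsup_le_of_le (by isBoundedDefault) ?_
  filter_upwards [hρ (e' / 2) (by positivity), hs.eventually_integral_norm_snd_le hH]
    with j h1 h2
  have hq := hH.integrable_norm_snd (hs.discMatherMeasure j).2.1
  have hi := integrable_one_sub_ballCutoff ρ (μs j : Measure (Euc N × Euc N))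
  have hcut : ∀ x : Euc N, 0 ≤ 1 - ballCutoff ρ x := fun x =>
    sub_nonneg.2 (ballCutoff_le_one ρ x)
  have hmarkov := mul_meas_ge_le_integral_of_nonneg (μ := (μs j : Measure (Euc N × Euc N)))
    (f := fun w => (1 - ballCutoff ρ w.1) + r⁻¹ * ‖w.2‖)
    (Filter.Eventually.of_forall fun w => add_nonneg (hcut w.1) (by positivity))
    (hi.add (hq.const_mul r⁻¹)) 1
  rw [integral_add hi (hq.const_mul r⁻¹), integral_const_mul, one_mul] at hmarkov
  have h3 : r⁻¹ * ∫ w, ‖w.2‖ ∂(μs j : Measure (Euc N × Euc N)) ≤ e' / 2 := by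
    rw [inv_mul_le_iff₀ hr2]
    rw [div_le_iff₀ (by positivity)] at hr3
    exact le_of_mul_le_mul_left (by linarith) hε
  have hsub : {w : Euc N × Euc N | r < ‖w‖} ⊆
      {w | 1 ≤ (1 - ballCutoff ρ w.1) + r⁻¹ * ‖w.2‖} := by
    intro w hw
    rcases lt_max_iff.1 (show r < max ‖w.1‖ ‖w.2‖ from hw) with h | h
    · have : 0 ≤ r⁻¹ * ‖w.2‖ := by positivity
      simp only [mem_ofPred_eq, ballCutoff_eq_zero (by linarith : ρ + 1 ≤ ‖w.1‖)]
      linarith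
    · have : 1 ≤ r⁻¹ * ‖w.2‖ := by
        rw [le_inv_mul_iff₀ hr2]
        linarith
      simp only [mem_ofPred_eq]
      linarith [hcut w.1]
  refine (measure_mono hsub).trans (le_trans ?_ he')
  rw [← ofReal_measureReal]
  exact ENNReal.ofReal_le_ofReal (by linarith)

theorem exists_subseq_tendsto (hs : IsVanishingDiscSeq H z lams ums μs)
    (hH : CriticalHamiltonian H ε δ R C) : ∃ φ : ℕ → ℕ, StrictMono φ ∧
      ∃ μ, Filter.Tendsto (fun n => μs (φ n)) Filter.atTop (nhds μ) := by
  have hcpt : IsCompact (closure (range μs)) := by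
    refine isCompact_closure_of_isTightMeasureSet ?_
    convert hs.isTightMeasureSet hH using 1
    ext ν
    simp
  obtain ⟨μ, -, φ, hφ, hμ⟩ := hcpt.tendsto_subseq fun n => subset_closure (mem_range_self n)
  exact ⟨φ, hφ, μ, hμ⟩

theorem integral_lag_le (hs : IsVanishingDiscSeq H z lams ums μs)
    (hH : CriticalHamiltonian H ε δ R C) (hμ : Filter.Tendsto μs Filter.atTop (nhds μ)) :
    Integrable (Lag H) (μ : Measure (Euc N × Euc N)) ∧
      ∫ w, Lag H w ∂(μ : Measure (Euc N × Euc N)) ≤ 0 := by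
  refine integral_le_of_tendsto hμ hH.continuous_lag
    ⟨-C, forall_mem_range.2 hH.neg_le_lag⟩ fun e he => ?_
  filter_upwards [hs.eventually_mul_le e he] with j hj
  obtain ⟨-, hLi, hLe, -⟩ := hs.discMatherMeasure j
  exact ⟨hLi, by linarith⟩

theorem exists_ae_norm_le (hs : IsVanishingDiscSeq H z lams ums μs)
    (hH : CriticalHamiltonian H ε δ R C) (hμ : Filter.Tendsto μs Filter.atTop (nhds μ)) :
    ∃ ρ : ℝ, 0 ≤ ρ ∧ ∀ᵐ w ∂(μ : Measure (Euc N × Euc N)), ‖w.1‖ ≤ ρ := by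
  obtain ⟨ρ, hρ⟩ := hs.exists_eventually_integral_cutoff_le hH
  have hnn : ∀ w : Euc N × Euc N, 0 ≤ 1 - ballCutoff ρ w.1 := fun w =>
    sub_nonneg.2 (ballCutoff_le_one ρ w.1)
  obtain ⟨hi, hle⟩ := integral_le_of_tendsto hμ (f := fun w => 1 - ballCutoff ρ w.1) (s := 0)
    (by fun_prop) ⟨0, forall_mem_range.2 hnn⟩ fun e he => by
      filter_upwards [hρ e he] with j hj
      exact ⟨integrable_one_sub_ballCutoff ρ _, by linarith⟩
  refine ⟨max 0 (ρ + 1), le_max_left _ _, ?_⟩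
  filter_upwards [(integral_eq_zero_iff_of_nonneg hnn hi).1
    (le_antisymm hle (integral_nonneg hnn))] with w hw
  refine le_max_of_le_right (le_of_not_gt fun h => ?_)
  simp [ballCutoff_eq_zero h.le] at hw

theorem integral_nonneg_of_subsolFor (hs : IsVanishingDiscSeq H z lams ums μs)
    (hH : CriticalHamiltonian H ε δ R C) (hμ : Filter.Tendsto μs Filter.atTop (nhds μ))
    {Φ : Euc N × Euc N → ℝ} (hΦ : Continuous Φ) (hb : BddBelow (range Φ)) {u : Euc N → ℝ}
    (hu : SubsolFor Φ u) (hΦint : Integrable Φ (μ : Measure (Euc N × Euc N))) :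
    0 ≤ ∫ w, Φ w ∂(μ : Measure (Euc N × Euc N)) := by
  obtain ⟨b₀, hb₀⟩ := hb
  obtain ⟨ρ, hρ0, hρ⟩ := hs.exists_ae_norm_le hH hμ
  have hLc := hH.continuous_lag
  obtain ⟨hLi, -⟩ := hs.integral_lag_le hH hμ
  obtain ⟨Ψ, v, S, K, lo, hi, hΨ, hv, hlo, hhi, hK, hΨb, hΨK, hΨS, hΨΦ⟩ :=
    hu.exists_localization hΦ (abs_nonneg b₀)
      (fun w => (neg_abs_le b₀).trans (hb₀ (mem_range_self w))) hρ0
  have hΨi : ∀ ν : ProbabilityMeasure (Euc N × Euc N), Integrable (Lag H) (ν : Measure _) →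
      Integrable Ψ (ν : Measure (Euc N × Euc N)) := by
    intro ν hν
    refine (((hH.integrable_norm_snd hν).const_mul K).add (integrable_const |b₀|)).mono'
      hΨ.aestronglyMeasurable (Filter.Eventually.of_forall fun w => ?_)
    have := mul_nonneg hK (norm_nonneg w.2)
    rw [Real.norm_eq_abs, abs_le]
    simp only [Pi.add_apply]
    constructor <;> linarith [hΨb w, hΨK w, abs_nonneg b₀]
  have key : ∀ η > 0, η * ∫ w, Lag H w ∂(μ : Measure (Euc N × Euc N)) ≤
      ∫ w, Ψ w ∂(μ : Measure (Euc N × Euc N)) := by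
    intro η hη
    obtain ⟨M, hM⟩ := hH.exists_mul_norm_le_lag S (k := K / η) (by positivity)
    have hbdd : BddBelow (range fun w => η * Lag H w - Ψ w) := by
      refine ⟨min (-(η * M)) (-(η * C)), forall_mem_range.2 fun w => ?_⟩
      rcases le_total ‖w.1‖ S with h | h
      · refine (min_le_left _ _).trans ?_
        have h1 := mul_le_mul_of_nonneg_left (hM w h) hη.le
        rw [← mul_assoc, mul_div_cancel₀ _ hη.ne'] at h1
        linarith [hΨK w]
      · refine (min_le_right _ _).trans ?_
        have h1 := mul_le_mul_of_nonneg_left (hH.neg_le_lag w) hη.le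
        linarith [hΨS w h]
    have hlim := integral_le_of_tendsto hμ (f := fun w => η * Lag H w - Ψ w) (s := 0)
      (by fun_prop) hbdd fun e he => by
        have hA : Filter.Tendsto (fun j => lams j * (hi - lo)) Filter.atTop (nhds 0) := by
          simpa using hs.tendsto_zero.mul_const (hi - lo)
        filter_upwards [hs.eventually_mul_le (e / (2 * η)) (by positivity),
          hA.eventually_lt_const (half_pos he)] with j h1 h2
        have hj := hs.discMatherMeasure j
        have hΨj := hΨi (μs j) hj.2.1
        have h3 := hj.neg_mul_le_integral (hs.pos j) hΨ
          ⟨-|b₀|, forall_mem_range.2 hΨb⟩ hΨj hv hlo hhi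
        refine ⟨(hj.2.1.const_mul η).sub hΨj, ?_⟩
        rw [integral_sub (hj.2.1.const_mul η) hΨj, integral_const_mul, hj.2.2.1]
        have h4 := mul_le_mul_of_nonneg_left h1 hη.le
        have h5 : η * (e / (2 * η)) = e / 2 := by field_simp
        linarith
    have h := hlim.2
    rw [integral_sub (hLi.const_mul η) (hΨi μ hLi), integral_const_mul] at h
    linarith
  have h0 : 0 ≤ ∫ w, Ψ w ∂(μ : Measure (Euc N × Euc N)) := by
    refine le_of_tendsto' (f := fun n : ℕ => (1 / ((n : ℝ) + 1)) *
      ∫ w, Lag H w ∂(μ : Measure (Euc N × Euc N))) (x := Filter.atTop) ?_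
      fun n => key _ Nat.one_div_pos_of_nat
    simpa using tendsto_one_div_add_atTop_nhds_zero_nat.mul_const
      (∫ w, Lag H w ∂(μ : Measure (Euc N × Euc N)))
  refine h0.trans (integral_mono_ae (hΨi μ hLi) hΦint ?_)
  filter_upwards [hρ] with w hw
  exact hΨΦ w hw

theorem matherMeasure (hs : IsVanishingDiscSeq H z lams ums μs)
    (hH : CriticalHamiltonian H ε δ R C) (hμ : Filter.Tendsto μs Filter.atTop (nhds μ)) :
    MatherMeasure H (μ : Measure (Euc N × Euc N)) := by
  obtain ⟨hLi, hLe⟩ := hs.integral_lag_le hH hμ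
  have hLc := hH.continuous_lag
  refine ⟨inferInstance, hLi, le_antisymm hLe (le_of_forall_pos_le_add fun a ha => ?_),
    fun Φ hΦ hb ⟨u, hu⟩ hΦint => hs.integral_nonneg_of_subsolFor hH hμ hΦ hb hu hΦint⟩
  obtain ⟨ρ, A, -, -, hv⟩ := hH.exists_bounded_subsol
  obtain ⟨v, hvL, -, hvae⟩ := hv a ha
  have h := hs.integral_nonneg_of_subsolFor hH hμ (Φ := fun w => Lag H w + a) (by fun_prop)
    ⟨-C + a, forall_mem_range.2 fun w => by linarith [hH.neg_le_lag w]⟩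
    (hH.subsolFor_of_le (g := fun _ => a) hvL (hvae.mono fun x hx => hx.1))
    (hLi.add (integrable_const a))
  rw [integral_add hLi (integrable_const a)] at h
  simpa using h

end IsVanishingDiscSeq

theorem stmt17 {N : ℕ} (hN : 1 ≤ N) (H : Euc N × Euc N → ℝ)
    (hA1 : Continuous H)
    (hA2conv : ∀ x : Euc N, ConvexOn ℝ Set.univ fun p => H (x, p))
    (hA2coer : ∀ R : ℝ, 0 < R → ∀ C : ℝ, ∃ r : ℝ, ∀ x p : Euc N,
      ‖x‖ ≤ R → r ≤ ‖p‖ → C ≤ H (x, p))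
    (hA3 : ∃ ε > (0 : ℝ), ∃ m : ℝ,
      (∃ R : ℝ, ∀ x : Euc N, R ≤ ‖x‖ → ∀ p : Euc N, ‖p‖ ≤ ε → H (x, p) ≤ m) ∧
      (∃ x₀ : Euc N, ∀ p : Euc N, m < H (x₀, p)))
    (hcrit : sInf {a : ℝ | ∃ u : Euc N → ℝ, IsSubsol H a u} = 0)
    (hsl : ∀ x : Euc N, ∀ C : ℝ, ∃ r : ℝ, ∀ p : Euc N, r ≤ ‖p‖ → C * ‖p‖ ≤ H (x, p))
    (um : ℝ → Euc N → ℝ)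
    (hum : ∀ lam : ℝ, 0 < lam → ∀ x : Euc N,
      um lam x = sSup {r : ℝ | ∃ v : Euc N → ℝ, IsDiscSubsol H lam v ∧ v x = r})
    (z : Euc N) (lamseq : ℕ → ℝ) (hpos : ∀ j, 0 < lamseq j)
    (hto0 : Filter.Tendsto lamseq Filter.atTop (nhds 0))
    (μseq : ℕ → ProbabilityMeasure (Euc N × Euc N))
    (hμ : ∀ j, DiscMatherMeasure H (lamseq j) z (um (lamseq j))
      (μseq j : Measure (Euc N × Euc N))) :
    (∃ φ : ℕ → ℕ, StrictMono φ ∧ ∃ μ : ProbabilityMeasure (Euc N × Euc N),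
      Filter.Tendsto (fun n => μseq (φ n)) Filter.atTop (nhds μ)) ∧
    (∀ φ : ℕ → ℕ, StrictMono φ → ∀ μ : ProbabilityMeasure (Euc N × Euc N),
      Filter.Tendsto (fun n => μseq (φ n)) Filter.atTop (nhds μ) →
      MatherMeasure H (μ : Measure (Euc N × Euc N))) := by
  obtain ⟨ε, δ, R, C, hH⟩ := exists_criticalHamiltonian hA1 hA2conv hA2coer hA3 hcrit hsl
  have hs : IsVanishingDiscSeq H z lamseq (fun j => um (lamseq j)) μseq := by
    refine ⟨hpos, hto0, hμ, fun η hη => ?_⟩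
    obtain ⟨lam₀, hlam₀, h⟩ := hH.exists_mul_le_of_isDiscSubsol z hη
    filter_upwards [hto0.eventually_lt_const hlam₀] with j hj
    rw [hum _ (hpos j), ← le_div_iff₀' (hpos j)]
    refine Real.sSup_le ?_ (div_nonneg hη.le (hpos j).le)
    rintro _ ⟨v, hv, rfl⟩
    rw [le_div_iff₀' (hpos j)]
    exact h _ (hpos j) hj v hv
  exact ⟨hs.exists_subseq_tendsto hH, fun φ hφ μ hlim => (hs.comp hφ).matherMeasure hH hlim⟩

end
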